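/- arXiv:1905.00833 — 3 statements merged into one kernel-verified Lean document; each statement's English description precedes it below -/
import Mathlib

section
/- (Swapping lemma variant.) Let α > 0 and let u, v : [0, ∞) → ℝ be continuous. Define the filters F[u](t) := α∫₀ᵗ e^{−α(t−s)} u(s) ds, G[u] := α·(u − F[u]), and H[u](t) := ∫₀ᵗ e^{−α(t−s)} u(s) ds. Then for all t ≥ 0: G[u·v](t) = G[u](t)·v(t) + F[u](t)·G[v](t) − H[ G[u]·G[v] ](t). -/
/-- The filter `F[u](t) = α ∫₀ᵗ e^{−α(t−s)} u(s) ds`, the zero-initial-condition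
realization of the transfer function `α/(p+α)`. -/
noncomputable def Ffilt (α : ℝ) (u : ℝ → ℝ) (t : ℝ) : ℝ :=
  α * ∫ s in (0 : ℝ)..t, Real.exp (-(α * (t - s))) * u s

/-- The filter `H[u](t) = ∫₀ᵗ e^{−α(t−s)} u(s) ds`, the zero-initial-condition
realization of the transfer function `1/(p+α)`. -/
noncomputable def Hfilt (α : ℝ) (u : ℝ → ℝ) (t : ℝ) : ℝ :=
  ∫ s in (0 : ℝ)..t, Real.exp (-(α * (t - s))) * u s

/-- The filter `G[u] = α (u − F[u])`, the zero-initial-condition realization of the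
transfer function `αp/(p+α)`. -/
noncomputable def Gfilt (α : ℝ) (u : ℝ → ℝ) (t : ℝ) : ℝ :=
  α * (u t - Ffilt α u t)

/-- The state equation `p F[u] = G[u]`. -/
theorem hasDerivAt_Ffilt (α : ℝ) {u : ℝ → ℝ} (hu : Continuous u) (t : ℝ) :
    HasDerivAt (Ffilt α u) (Gfilt α u t) t := by
  have key : ∀ r, Ffilt α u r
      = α * (Real.exp (-(α * r)) * ∫ s in (0 : ℝ)..r, Real.exp (α * s) * u s) := by
    intro r
    rw [Ffilt, ← intervalIntegral.integral_const_mul (Real.exp (-(α * r)))]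
    congr 2
    funext s
    rw [← mul_assoc, ← Real.exp_add]
    congr 2
    ring
  have hc : Continuous fun s => Real.exp (α * s) * u s := by fun_prop
  have h1 : HasDerivAt (fun r => ∫ s in (0 : ℝ)..r, Real.exp (α * s) * u s)
      (Real.exp (α * t) * u t) t := hc.integral_hasStrictDerivAt 0 t |>.hasDerivAt
  have h2 : HasDerivAt (fun r => Real.exp (-(α * r))) (Real.exp (-(α * t)) * (-(α * 1))) t :=
    (((hasDerivAt_id t).const_mul α).neg).exp
  have h3 := (h2.mul h1).const_mul α
  have he : Real.exp (-(α * t)) * Real.exp (α * t) = 1 := by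
    rw [← Real.exp_add, neg_add_cancel, Real.exp_zero]
  rw [funext key]
  refine h3.congr_deriv ?_
  rw [Gfilt, key]
  linear_combination α * u t * he

/-- `1/(p+α)` inverts `p+α` on functions vanishing at the origin. -/
theorem Hfilt_deriv_add (α : ℝ) {y y' : ℝ → ℝ} (hy : ∀ s, HasDerivAt y (y' s) s)
    (hy' : Continuous y') (h0 : y 0 = 0) (t : ℝ) :
    Hfilt α (fun s => y' s + α * y s) t = y t := by
  have hyc : Continuous y := continuous_iff_continuousAt.2 fun s => (hy s).continuousAt
  have hd : ∀ s, HasDerivAt (fun s => Real.exp (-(α * (t - s))) * y s)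
      (Real.exp (-(α * (t - s))) * (y' s + α * y s)) s := by
    intro s
    have h1 : HasDerivAt (fun s => Real.exp (-(α * (t - s))))
        (Real.exp (-(α * (t - s))) * (-(α * (-1)))) s :=
      ((((hasDerivAt_id s).const_sub t).const_mul α).neg).exp
    refine (h1.mul (hy s)).congr_deriv ?_
    ring
  rw [Hfilt, intervalIntegral.integral_eq_sub_of_hasDerivAt (fun s _ => hd s)
    (Continuous.intervalIntegrable (by fun_prop) _ _)]
  simp [h0]

theorem Hfilt_sub_const_mul (α c : ℝ) {f g : ℝ → ℝ} (hf : Continuous f) (hg : Continuous g)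
    (t : ℝ) : Hfilt α (fun s => c * f s - g s) t = c * Hfilt α f t - Hfilt α g t := by
  rw [Hfilt, Hfilt, Hfilt, ← intervalIntegral.integral_const_mul,
    ← intervalIntegral.integral_sub
      (Continuous.intervalIntegrable (by fun_prop) _ _)
      (Continuous.intervalIntegrable (by fun_prop) _ _)]
  congr 1
  funext s
  ring

theorem Hfilt_congr (α : ℝ) {f g : ℝ → ℝ} {t : ℝ} (ht : 0 ≤ t)
    (h : ∀ s, 0 ≤ s → f s = g s) : Hfilt α f t = Hfilt α g t := by
  refine intervalIntegral.integral_congr fun s hs => ?_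
  rw [Set.uIcc_of_le ht] at hs
  simp only [h s hs.1]

theorem Ffilt_congr (α : ℝ) {f g : ℝ → ℝ} {t : ℝ} (ht : 0 ≤ t)
    (h : ∀ s, 0 ≤ s → f s = g s) : Ffilt α f t = Ffilt α g t :=
  congrArg (α * ·) (Hfilt_congr α ht h)

theorem Gfilt_congr (α : ℝ) {f g : ℝ → ℝ} {t : ℝ} (ht : 0 ≤ t)
    (h : ∀ s, 0 ≤ s → f s = g s) : Gfilt α f t = Gfilt α g t := by
  rw [Gfilt, Gfilt, h t ht, Ffilt_congr α ht h]

/-- The swapping identity for signals that are continuous on the whole line. -/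
theorem Gfilt_mul_of_continuous (α : ℝ) {u v : ℝ → ℝ} (hu : Continuous u) (hv : Continuous v)
    (t : ℝ) :
    Gfilt α (fun s => u s * v s) t
      = Gfilt α u t * v t + Ffilt α u t * Gfilt α v t
        - Hfilt α (fun s => Gfilt α u s * Gfilt α v s) t := by
  have hF : ∀ {w : ℝ → ℝ}, Continuous w → Continuous (Ffilt α w) := fun hw =>
    continuous_iff_continuousAt.2 fun s => (hasDerivAt_Ffilt α hw s).continuousAt
  have hG : ∀ {w : ℝ → ℝ}, Continuous w → Continuous (Gfilt α w) := fun hw =>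
    continuous_const.mul (hw.sub (hF hw))
  have hFu := hF hu
  have hFv := hF hv
  have hGu := hG hu
  have hGv := hG hv
  have hy := Hfilt_deriv_add α (y := fun s => α * (Ffilt α u s * Ffilt α v s))
    (fun s => ((hasDerivAt_Ffilt α hu s).mul (hasDerivAt_Ffilt α hv s)).const_mul α)
    (by fun_prop) (by simp [Ffilt]) t
  have hl := Hfilt_sub_const_mul α (α ^ 2) (hu.mul hv) (hGu.mul hGv) t
  have hfun : (fun s => α * (Gfilt α u s * Ffilt α v s + Ffilt α u s * Gfilt α v s)
        + α * (α * (Ffilt α u s * Ffilt α v s)))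
      = fun s => α ^ 2 * (u s * v s) - Gfilt α u s * Gfilt α v s := by
    funext s
    simp only [Gfilt]
    ring
  rw [hfun] at hy
  have hFuv : Ffilt α (fun s => u s * v s) t = α * Hfilt α (fun s => u s * v s) t := rfl
  have hGuv : Gfilt α (fun s => u s * v s) t
      = α * (u t * v t - Ffilt α (fun s => u s * v s) t) := rfl
  have hGut : Gfilt α u t = α * (u t - Ffilt α u t) := rfl
  have hGvt : Gfilt α v t = α * (v t - Ffilt α v t) := rfl
  rw [hGuv, hFuv, hGut, hGvt]
  linear_combination hl - hy

/-- Swapping lemma variant: for `α > 0` and continuous `u, v : [0,∞) → ℝ`,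
`G[uv] = G[u]·v + F[u]·G[v] − H[G[u]·G[v]]` on `[0,∞)`. -/
theorem stmt4 (α : ℝ) (hα : 0 < α) (u v : ℝ → ℝ)
    (hu : ContinuousOn u (Set.Ici 0)) (hv : ContinuousOn v (Set.Ici 0)) :
    ∀ t, 0 ≤ t →
      Gfilt α (fun s => u s * v s) t
        = Gfilt α u t * v t + Ffilt α u t * Gfilt α v t
          - Hfilt α (fun s => Gfilt α u s * Gfilt α v s) t := by
  intro t ht
  have hext : ∀ {w : ℝ → ℝ}, ContinuousOn w (Set.Ici 0) → Continuous fun s => w (max s 0) :=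
    fun hw => hw.comp_continuous (by fun_prop) fun s => le_max_right s 0
  have heq : ∀ (w : ℝ → ℝ) (s : ℝ), 0 ≤ s → w s = w (max s 0) := fun w s hs => by
    rw [max_eq_left hs]
  rw [Gfilt_congr α ht (heq fun s => u s * v s), Gfilt_congr α ht (heq u),
    Gfilt_congr α ht (heq v), Ffilt_congr α ht (heq u), heq v t ht,
    Hfilt_congr α ht fun s hs => congrArg₂ (· * ·) (Gfilt_congr α hs (heq u))
      (Gfilt_congr α hs (heq v))]
  exact Gfilt_mul_of_continuous α (hext hu) (hext hv) t
end

section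
/- Let a, b ∈ ℝ² be nonzero and u ∈ ℝ². Then uᵀ( a/‖a‖ − b/‖b‖ ) = (a − b)ᵀ · (1/‖a‖)·[ I₂ − ((b + a)bᵀ)/(‖b‖·(‖b‖ + ‖a‖)) ] · u, where (b+a)bᵀ denotes the outer product matrix. -/
open scoped RealInnerProductSpace

/-- View a Euclidean plane vector as a plain function `Fin 2 → ℝ`. -/
noncomputable def ofE (v : EuclideanSpace ℝ (Fin 2)) : Fin 2 → ℝ :=
  WithLp.equiv 2 (Fin 2 → ℝ) v

/-- for nonzero `a, b ∈ ℝ²` and any `u ∈ ℝ²`,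
`uᵀ(a/‖a‖ − b/‖b‖) = (a − b)ᵀ (1/‖a‖)[I₂ − (b+a)bᵀ/(‖b‖(‖b‖+‖a‖))] u`. -/
theorem stmt6 (a b u : EuclideanSpace ℝ (Fin 2)) (ha : a ≠ 0) (hb : b ≠ 0) :
    ⟪u, ‖a‖⁻¹ • a - ‖b‖⁻¹ • b⟫
      = ⟪a - b, ‖a‖⁻¹ •
          Matrix.toEuclideanLin
            ((1 : Matrix (Fin 2) (Fin 2) ℝ)
              - (‖b‖ * (‖b‖ + ‖a‖))⁻¹ • Matrix.vecMulVec (ofE (b + a)) (ofE b)) u⟫ := by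
  have hmat : Matrix.toEuclideanLin
      ((1 : Matrix (Fin 2) (Fin 2) ℝ)
        - (‖b‖ * (‖b‖ + ‖a‖))⁻¹ • Matrix.vecMulVec (ofE (b + a)) (ofE b)) u
      = u - ((‖b‖ * (‖b‖ + ‖a‖))⁻¹ * ⟪b, u⟫) • (b + a) := by
    ext i
    simp [Matrix.toLpLin_apply,
      Matrix.vecMulVec_mulVec, ofE, PiLp.inner_apply, dotProduct, Fin.sum_univ_two]
    ring
  have hinner : ⟪a - b, b + a⟫ = ‖a‖ ^ 2 - ‖b‖ ^ 2 := by
    rw [add_comm b a, inner_sub_left, inner_add_right, inner_add_right,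
      real_inner_self_eq_norm_sq, real_inner_self_eq_norm_sq, real_inner_comm a b]
    ring
  have ha' : 0 < ‖a‖ := norm_pos_iff.mpr ha
  have hb' : 0 < ‖b‖ := norm_pos_iff.mpr hb
  rw [hmat, inner_smul_right, inner_sub_right, inner_sub_right, inner_smul_right,
    inner_smul_right, inner_smul_right, hinner, inner_sub_left,
    real_inner_comm a u, real_inner_comm b u]
  field_simp
  ring
end

section
/- (Persistency of excitation at standstill under probing.) Let L_0 ∈ ℝ with L_0 ≠ 0, ψ_m ∈ ℝ, and let θ₀ ∈ ℝ be a constant (rotor at standstill). Let i : [0,∞) → ℝ² be continuously differentiable and suppose its time derivative di/dt is persistently exciting. Then the signal t ↦ (d/dt)[ −(L_0/2)·i(t) + (L_0·(i(t)ᵀc(θ₀)) + ψ_m)·c(θ₀) ], which equals t ↦ L_0·( −(1/2)·I₂ + c(θ₀)c(θ₀)ᵀ )·(di/dt)(t), is persistently exciting. -/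
open scoped RealInnerProductSpace

/-- A signal `u : [0,∞) → ℝⁿ` is persistently exciting with constants `δ > 0`, `T > 0` if
`∫ₜ^{t+T} u(s)u(s)ᵀ ds ⪰ δ Iₙ` for all `t ≥ 0`, i.e. (in quadratic-form terms, which is
equivalent to the Loewner order condition) `∫ₜ^{t+T} (u(s)ᵀw)² ds ≥ δ ‖w‖²` for every
`w ∈ ℝⁿ` and every `t ≥ 0`. -/
def IsPE {n : ℕ} (u : ℝ → EuclideanSpace ℝ (Fin n)) (δ T : ℝ) : Prop :=
  ∀ t, 0 ≤ t → ∀ w : EuclideanSpace ℝ (Fin n),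
    δ * ‖w‖ ^ 2 ≤ ∫ s in t..(t + T), ⟪u s, w⟫ ^ 2

/-- The unit vector at angle `θ` in the Euclidean plane: `c(θ) = (cos θ, sin θ)ᵀ`. -/
noncomputable def cE (θ : ℝ) : EuclideanSpace ℝ (Fin 2) :=
  (WithLp.equiv 2 (Fin 2 → ℝ)).symm ![Real.cos θ, Real.sin θ]

theorem norm_cE (θ : ℝ) : ‖cE θ‖ = 1 := by
  simp [cE, EuclideanSpace.norm_eq, Fin.sum_univ_two]

theorem toEuclideanLin_vecMulVec_ofE (c v : EuclideanSpace ℝ (Fin 2)) :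
    Matrix.toEuclideanLin (Matrix.vecMulVec (ofE c) (ofE c)) v = ⟪v, c⟫ • c := by
  ext k
  fin_cases k <;>
    simp [ofE, Matrix.toLpLin_apply, Matrix.vecMulVec_apply,
      PiLp.inner_apply, Fin.sum_univ_two] <;> ring

section InnerProductSpace

variable {E : Type*} [NormedAddCommGroup E] [InnerProductSpace ℝ E]

theorem hasDerivAt_smul_add_inner_smul {f : ℝ → E} {f' : E} {t : ℝ} (hf : HasDerivAt f f' t)
    (L ψ : ℝ) (c : E) :
    HasDerivAt (fun s => -(L / 2) • f s + (L * ⟪f s, c⟫ + ψ) • c)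
      (-(L / 2) • f' + (L * ⟪f', c⟫) • c) t := by
  have h : HasDerivAt (fun s => ⟪f s, c⟫) ⟪f', c⟫ t := by
    simpa using hf.inner ℝ (hasDerivAt_const t c)
  exact (hf.const_smul (-(L / 2))).add (((h.const_mul L).add_const ψ).smul_const c)

theorem inner_smul_add_inner_smul (L : ℝ) (c v w : E) :
    ⟪-(L / 2) • v + (L * ⟪v, c⟫) • c, w⟫ = ⟪v, -(L / 2) • w + (L * ⟪w, c⟫) • c⟫ := by
  simp only [inner_add_left, inner_add_right, real_inner_smul_left, real_inner_smul_right,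
    real_inner_comm c w]
  ring

theorem norm_smul_add_inner_smul_sq (L : ℝ) {c : E} (hc : ‖c‖ = 1) (w : E) :
    ‖-(L / 2) • w + (L * ⟪w, c⟫) • c‖ ^ 2 = L ^ 2 / 4 * ‖w‖ ^ 2 := by
  rw [norm_add_sq_real, norm_smul, norm_smul, real_inner_smul_left, real_inner_smul_right, hc,
    mul_pow, Real.norm_eq_abs, Real.norm_eq_abs, sq_abs, mul_one, sq_abs]
  ring

end InnerProductSpace

/-- persistency of excitation at standstill under probing: if `L_0 ≠ 0`,
the rotor angle is constant `θ₀`, `i` is continuously differentiable and `di/dt` is PE,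
then `t ↦ (d/dt)[−(L_0/2) i + (L_0 iᵀc(θ₀) + ψ_m) c(θ₀)]`, which equals
`t ↦ L_0 (−(1/2) I₂ + c(θ₀)c(θ₀)ᵀ) (di/dt)(t)`, is PE. -/
theorem stmt14 (L0 ψm θ₀ : ℝ) (hL0 : L0 ≠ 0)
    (i : ℝ → EuclideanSpace ℝ (Fin 2)) (hi : ContDiff ℝ 1 i)
    (δ T : ℝ) (hδ : 0 < δ) (hT : 0 < T) (hPE : IsPE (fun t => deriv i t) δ T) :
    (∀ t, deriv (fun s => -(L0 / 2) • i s + (L0 * ⟪i s, cE θ₀⟫ + ψm) • cE θ₀) t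
        = L0 • Matrix.toEuclideanLin
            (-(1 / 2 : ℝ) • (1 : Matrix (Fin 2) (Fin 2) ℝ)
              + Matrix.vecMulVec (ofE (cE θ₀)) (ofE (cE θ₀)))
            (deriv i t)) ∧
    ∃ δ' T', 0 < δ' ∧ 0 < T' ∧
      IsPE (fun t =>
          deriv (fun s => -(L0 / 2) • i s + (L0 * ⟪i s, cE θ₀⟫ + ψm) • cE θ₀) t)
        δ' T' := by
  have hderiv (t : ℝ) :
      deriv (fun s => -(L0 / 2) • i s + (L0 * ⟪i s, cE θ₀⟫ + ψm) • cE θ₀) t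
        = -(L0 / 2) • deriv i t + (L0 * ⟪deriv i t, cE θ₀⟫) • cE θ₀ :=
    (hasDerivAt_smul_add_inner_smul (hi.differentiable one_ne_zero t).hasDerivAt L0 ψm _).deriv
  refine ⟨fun t => ?_, L0 ^ 2 / 4 * δ, T, by positivity, hT, fun t ht w => ?_⟩
  · rw [hderiv, map_add, LinearMap.add_apply, toEuclideanLin_vecMulVec_ofE, map_smul,
      LinearMap.smul_apply, Matrix.toLpLin_one, LinearMap.id_apply]
    module
  · simp only [hderiv, inner_smul_add_inner_smul]
    have h := hPE t ht (-(L0 / 2) • w + (L0 * ⟪w, cE θ₀⟫) • cE θ₀)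
    rw [norm_smul_add_inner_smul_sq L0 (norm_cE θ₀)] at h
    linarith
end
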